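/- arXiv:1809.03024 — 6 statements merged into one kernel-verified Lean document; each statement's English description precedes it below -/
import Mathlib

section
/- Theorem 1 (Decoding/Decryption Guarantee). Let p > 2 and suppose r ≥ 2 and n ≥ r + 1. Set s = r − 1. Let C be an s × n matrix over 𝔽_p whose rows all belong to Γ(L, g), and let E be an s × n matrix over 𝔽_p that has exactly r − 1 nonzero columns and rank r − 1 (i.e., E is a full-rank burst error of weight r − 1). Set R = C + E. Then C is the unique decoding result: for every s × n matrix C′ over 𝔽_p whose rows all belong to Γ(L, g) and such that R − C′ has at most r − 1 nonzero columns, one has C′ = C. -/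
open Polynomial Finset

/-- The Goppa code attached to `g` has minimum distance greater than `g.natDegree`:
a codeword supported on at most `g.natDegree` positions vanishes. -/
theorem goppa_codeword_eq_zero {F ι : Type*} [Field F] [Fintype ι] [DecidableEq ι]
    {α : ι → F} (hα : Function.Injective α) {g : F[X]}
    (hgα : ∀ i, g.eval (α i) ≠ 0) {f : ι → F} {T : Finset ι}
    (hT : ∀ i, i ∉ T → f i = 0) (hcard : T.card ≤ g.natDegree)
    (hdvd : g ∣ ∑ i, Polynomial.C (f i) *
      ∏ j ∈ Finset.univ.erase i, (X - Polynomial.C (α j))) :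
    f = 0 := by
  set S : F[X] := ∑ i ∈ T, Polynomial.C (f i) * ∏ j ∈ T.erase i, (X - Polynomial.C (α j))
    with hS
  have hfactor : ∑ i, Polynomial.C (f i) *
      ∏ j ∈ Finset.univ.erase i, (X - Polynomial.C (α j)) =
      (∏ j ∈ Tᶜ, (X - Polynomial.C (α j))) * S := by
    rw [hS, Finset.mul_sum, ← Finset.sum_subset (Finset.subset_univ T)]
    · refine Finset.sum_congr rfl fun i hi => ?_
      have hunion : Finset.univ.erase i = Tᶜ ∪ T.erase i := by
        ext j
        simp only [mem_erase, mem_univ, mem_union, mem_compl]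
        grind
      have hdisj : Disjoint Tᶜ (T.erase i) :=
        disjoint_compl_left.mono_right (Finset.erase_subset i T)
      rw [hunion, Finset.prod_union hdisj]
      ring
    · intro i _ hi
      simp [hT i hi]
  have hcop : IsCoprime g (∏ j ∈ Tᶜ, (X - Polynomial.C (α j))) := by
    refine IsCoprime.prod_right fun j _ => IsCoprime.symm ?_
    rw [(irreducible_X_sub_C (α j)).coprime_iff_not_dvd, dvd_iff_isRoot]
    exact hgα j
  rw [hfactor] at hdvd
  have hgS : g ∣ S := hcop.dvd_of_dvd_mul_left hdvd
  have hg0 (i : ι) : g ≠ 0 := by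
    rintro rfl
    simpa using hgα i
  funext i
  by_cases hi : i ∈ T
  swap
  · exact hT i hi
  have hdegS : S.degree < g.degree := by
    rw [degree_eq_natDegree (hg0 i), hS]
    refine (degree_sum_le _ _).trans_lt ?_
    rw [Finset.sup_lt_iff (WithBot.bot_lt_coe _)]
    intro k hk
    rw [C_mul']
    refine (degree_smul_le _ _).trans_lt ?_
    rw [degree_prod]
    simp only [degree_X_sub_C, sum_const, nsmul_eq_mul, mul_one]
    have := Finset.card_erase_lt_of_mem hk
    exact_mod_cast this.trans_le hcard
  have hS0 : S = 0 := eq_zero_of_dvd_of_degree_lt hgS hdegS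
  have heval : S.eval (α i) = f i * ∏ j ∈ T.erase i, (α i - α j) := by
    rw [hS, eval_finsetSum, Finset.sum_eq_single_of_mem i hi]
    · simp [eval_prod]
    · intro k _ hk
      rw [eval_mul, eval_prod, Finset.prod_eq_zero (Finset.mem_erase.2 ⟨hk.symm, hi⟩), mul_zero]
      simp
  rw [hS0, eval_zero] at heval
  refine (mul_eq_zero.1 heval.symm).resolve_right (Finset.prod_ne_zero_iff.2 fun j hj => ?_)
  exact sub_ne_zero.2 fun h => (Finset.mem_erase.1 hj).1 (hα h).symm

/-- A full-rank matrix with as many nonzero columns as rows can be brought, by an invertible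
row transformation, to a form in which every row has at most one nonzero entry. -/
theorem exists_isUnit_mul_row_support {K ι : Type*} [Field K] [DecidableEq K] [Fintype ι]
    [DecidableEq ι] {s : ℕ} (E : Matrix (Fin s) ι K)
    (hsupp : (Finset.univ.filter fun i : ι => ∃ a, E a i ≠ 0).card = s)
    (hrank : E.rank = s) :
    ∃ (A : Matrix (Fin s) (Fin s) K) (e : Fin s → ι), IsUnit A ∧
      ∀ a i, i ≠ e a → (A * E) a i = 0 := by
  have e : Fin s ≃ (Finset.univ.filter fun i : ι => ∃ a, E a i ≠ 0) :=
    (Finset.equivFinOfCardEq hsupp).symm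
  set M : Matrix (Fin s) (Fin s) K := E.submatrix id (fun b => (e b : ι)) with hM
  set P : Matrix (Fin s) ι K := Matrix.of fun b i => if i = e b then 1 else 0 with hP
  have hEMP : E = M * P := by
    ext a i
    simp only [hM, hP, Matrix.mul_apply, Matrix.submatrix_apply, Matrix.of_apply, id, mul_ite, mul_one, mul_zero]
    by_cases hi : ∃ a, E a i ≠ 0
    · have hmem : i ∈ Finset.univ.filter fun i : ι => ∃ a, E a i ≠ 0 := by simpa using hi
      rw [Finset.sum_eq_single (e.symm ⟨i, hmem⟩)]
      · simp
      · intro b _ hb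
        refine if_neg fun h => hb ?_
        rw [Equiv.eq_symm_apply]
        exact Subtype.ext h.symm
      · simp
    · push Not at hi
      rw [hi a, Finset.sum_eq_zero]
      intro b _
      split_ifs with h
      · rw [← h, hi a]
      · rfl
  have hMrank : M.rank = s := by
    refine le_antisymm (by simpa using M.rank_le_card_width) ?_
    calc s = (M * P).rank := by rw [← hEMP, hrank]
      _ ≤ M.rank := Matrix.rank_mul_le_left M P
  have hMunit : IsUnit M := by
    rw [← Matrix.linearIndependent_rows_iff_isUnit, linearIndependent_iff_card_eq_finrank_span,
      Set.finrank, ← Matrix.rank_eq_finrank_span_row, hMrank, Fintype.card_fin]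
  have hdet : IsUnit M.det := (Matrix.isUnit_iff_isUnit_det M).1 hMunit
  refine ⟨M⁻¹, fun b => e b, (Matrix.isUnit_nonsing_inv_iff).2 hMunit, fun a i hi => ?_⟩
  rw [hEMP, Matrix.nonsing_inv_mul_cancel_left _ _ hdet]
  exact if_neg hi

/-- **Theorem 1 (Decoding/Decryption Guarantee).**
Let `p > 2` be a prime, `q = p^m`, `r ≥ 2`, `n ≥ r + 1`, and set `s = r - 1`.
Let `C` be an `s × n` matrix over `𝔽_p` whose rows all belong to the Goppa code
`Γ(L, g)` and let `E` be an `s × n` matrix over `𝔽_p` with exactly `r - 1` nonzero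
columns and rank `r - 1`.  Set `R = C + E`.  Then `C` is the unique decoding result:
for every `s × n` matrix `C'` over `𝔽_p` whose rows all belong to `Γ(L, g)` and such
that `R - C'` has at most `r - 1` nonzero columns, one has `C' = C`. -/
theorem interleaved_goppa_decoding_guarantee
    (p m n r : ℕ) [Fact p.Prime] (hp : 2 < p) (hm : 0 < m)
    {F : Type*} [Field F] [Fintype F] [DecidableEq F] [Algebra (ZMod p) F]
    (hcard : Fintype.card F = p ^ m)
    (hr : 2 ≤ r) (hn : r + 1 ≤ n)
    (α : Fin n → F) (hα : Function.Injective α)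
    (g : F[X]) (hg : g.Monic) (hdeg : g.natDegree = r)
    (hgα : ∀ i, g.eval (α i) ≠ 0)
    (C E : Matrix (Fin (r - 1)) (Fin n) (ZMod p))
    (hC : ∀ a, g ∣ ∑ i : Fin n,
      Polynomial.C (algebraMap (ZMod p) F (C a i)) *
        ∏ j ∈ Finset.univ.erase i, (X - Polynomial.C (α j)))
    (hEsupp : (Finset.univ.filter fun i : Fin n => ∃ a, E a i ≠ 0).card = r - 1)
    (hErank : E.rank = r - 1)
    (C' : Matrix (Fin (r - 1)) (Fin n) (ZMod p))
    (hC' : ∀ a, g ∣ ∑ i : Fin n,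
      Polynomial.C (algebraMap (ZMod p) F (C' a i)) *
        ∏ j ∈ Finset.univ.erase i, (X - Polynomial.C (α j)))
    (hburst : (Finset.univ.filter fun i : Fin n => ∃ a, (C + E - C') a i ≠ 0).card ≤ r - 1) :
    C' = C := by
  obtain ⟨A, e, hA, hAE⟩ := exists_isUnit_mul_row_support E hEsupp hErank
  set T := Finset.univ.filter fun i : Fin n => ∃ a, (C + E - C') a i ≠ 0
  have hcode (a) : g ∣ ∑ i : Fin n,
      Polynomial.C (algebraMap (ZMod p) F ((A * (C - C')) a i)) *
        ∏ j ∈ Finset.univ.erase i, (X - Polynomial.C (α j)) := by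
    have hlin : ∑ i : Fin n, Polynomial.C (algebraMap (ZMod p) F ((A * (C - C')) a i)) *
        ∏ j ∈ Finset.univ.erase i, (X - Polynomial.C (α j)) =
        ∑ b, Polynomial.C (algebraMap (ZMod p) F (A a b)) *
          (∑ i : Fin n, Polynomial.C (algebraMap (ZMod p) F (C b i)) *
              ∏ j ∈ Finset.univ.erase i, (X - Polynomial.C (α j)) -
            ∑ i : Fin n, Polynomial.C (algebraMap (ZMod p) F (C' b i)) *
              ∏ j ∈ Finset.univ.erase i, (X - Polynomial.C (α j))) := by
      simp only [Matrix.mul_apply, Matrix.sub_apply, map_sum, map_mul, map_sub,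
        ← Finset.sum_sub_distrib, Finset.mul_sum, Finset.sum_mul]
      rw [Finset.sum_comm]
      refine Finset.sum_congr rfl fun b _ => Finset.sum_congr rfl fun i _ => ?_
      ring
    rw [hlin]
    exact Finset.dvd_sum fun b _ => (dvd_sub (hC b) (hC' b)).mul_left _
  have hzero : A * (C - C') = 0 := by
    ext a i
    have hsupp (i) (hi : i ∉ insert (e a) T) :
        algebraMap (ZMod p) F ((A * (C - C')) a i) = 0 := by
      rw [Finset.mem_insert, not_or] at hi
      have hcol (b) : (C + E - C') b i = 0 := by
        by_contra h
        exact hi.2 (Finset.mem_filter.2 ⟨Finset.mem_univ i, b, h⟩)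
      have hsplit : C - C' = (C + E - C') - E := by abel
      rw [hsplit, Matrix.mul_sub, Matrix.sub_apply, hAE a i hi.1, Matrix.mul_apply]
      simp [hcol]
    have hcardT : (insert (e a) T).card ≤ g.natDegree := by
      have := Finset.card_insert_le (e a) T
      omega
    have h := congrFun (goppa_codeword_eq_zero hα hgα hsupp hcardT (hcode a)) i
    exact (map_eq_zero (algebraMap (ZMod p) F)).1 h
  have hsub : C - C' = 0 := by
    have hdet : IsUnit A.det := (Matrix.isUnit_iff_isUnit_det A).1 hA
    rw [← Matrix.nonsing_inv_mul_cancel_left A (C - C') hdet, hzero, Matrix.mul_zero]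
  exact (sub_eq_zero.1 hsub).symm
end

section
/- Uniqueness of full-rank burst errors for interleaved generalized Reed–Solomon codes (Metzner–Kapturowski-type uniqueness used in the proof of Theorem 1). Let s and t be positive integers with t ≤ n − k − 1. Let E and E′ be s × n matrices over 𝔽_q such that: E has exactly t nonzero columns and rank t; E′ has at most t nonzero columns; and every row of E − E′ belongs to GRS_{n,k}. Then E′ = E. -/
open Polynomial Finset

/-- A word of `GRS_{n,k}` vanishing outside a set of at most `n - k` positions is zero. -/
theorem grs_eval_eq_zero_of_support_subset {F : Type*} [Field F] {n k : ℕ} (hkn : k ≤ n)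
    {α : Fin n → F} (hα : Function.Injective α) {ν : Fin n → F} (hν : ∀ i, ν i ≠ 0)
    {f : F[X]} (hf : f.degree < (k : WithBot ℕ)) {S : Finset (Fin n)} (hS : S.card ≤ n - k)
    (hsupp : ∀ i ∉ S, ν i * f.eval (α i) = 0) : f = 0 := by
  refine Polynomial.eq_zero_of_degree_lt_of_eval_index_eq_zero Sᶜ hα.injOn ?_ ?_
  · refine hf.trans_le ?_
    have hcard : k ≤ (Sᶜ).card := by
      rw [Finset.card_compl, Fintype.card_fin]
      omega
    exact_mod_cast hcard
  · intro i hi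
    exact (mul_eq_zero.mp (hsupp i (Finset.mem_compl.mp hi))).resolve_left (hν i)

/-- If every row of `D` is a word of `GRS_{n,k}`, then so is every combination of its rows. -/
theorem exists_polynomial_vecMul_of_rows {F : Type*} [Field F] {n k s : ℕ}
    {α ν : Fin n → F} {D : Matrix (Fin s) (Fin n) F}
    (hrow : ∀ a, ∃ f : F[X], f.degree < (k : WithBot ℕ) ∧ ∀ i, D a i = ν i * f.eval (α i))
    (u : Fin s → F) :
    ∃ f : F[X], f.degree < (k : WithBot ℕ) ∧
      ∀ i, Matrix.vecMul u D i = ν i * f.eval (α i) := by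
  choose f hf hD using hrow
  refine ⟨∑ a, u a • f a, ?_, fun i => ?_⟩
  · rw [← Polynomial.mem_degreeLT]
    exact Submodule.sum_mem _ fun a _ =>
      Submodule.smul_mem _ _ (Polynomial.mem_degreeLT.mpr (hf a))
  · simp only [Matrix.vecMul, dotProduct, hD, Polynomial.eval_finsetSum,
      Polynomial.eval_smul, smul_eq_mul, Finset.mul_sum]
    exact Finset.sum_congr rfl fun a _ => by ring

/-- If the rank of a matrix equals the size of a set containing its column support, then every
unit vector supported on that set is a combination of the rows. -/
theorem exists_vecMul_eq_single {F : Type*} [Field F] {n s : ℕ}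
    {E : Matrix (Fin s) (Fin n) F} {J : Finset (Fin n)} (hsupp : ∀ i ∉ J, ∀ a, E a i = 0)
    (hrank : E.rank = J.card) {j : Fin n} (hj : j ∈ J) :
    ∃ u : Fin s → F, Matrix.vecMul u E = Pi.single j 1 := by
  have hspan : Submodule.span F (Set.range E.col) ≤
      Submodule.span F (Set.range fun i : J => E.col i) := by
    rw [Submodule.span_le]
    rintro _ ⟨i, rfl⟩
    by_cases hi : i ∈ J
    · exact Submodule.subset_span ⟨⟨i, hi⟩, rfl⟩
    · have hzero : E.col i = 0 := funext fun a => hsupp i hi a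
      rw [hzero]
      exact Submodule.zero_mem _
  have hli : LinearIndependent F fun i : J => E.col i := by
    rw [linearIndependent_iff_card_le_finrank_span, Fintype.card_coe, ← hrank,
      Matrix.rank_eq_finrank_span_cols]
    exact Submodule.finrank_mono hspan
  obtain ⟨g, hg⟩ := LinearMap.exists_leftInverse_of_injective
    (Fintype.linearCombination F fun i : J => E.col i)
    (LinearMap.ker_eq_bot.mpr hli.fintypeLinearCombination_injective)
  have hgcol (i : J) : g (E.col i) = Pi.single i 1 := by
    have h := LinearMap.congr_fun hg (Pi.single i 1)
    simpa [Fintype.linearCombination_apply_single] using h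
  refine ⟨fun a => g (Pi.single a 1) ⟨j, hj⟩, funext fun i => ?_⟩
  have hmul : Matrix.vecMul (fun a => g (Pi.single a 1) ⟨j, hj⟩) E i = g (E.col i) ⟨j, hj⟩ := by
    conv_rhs => rw [pi_eq_sum_univ' (E.col i)]
    simp only [map_sum, map_smul, Finset.sum_apply, Pi.smul_apply, smul_eq_mul,
      Matrix.vecMul, dotProduct, Matrix.col_apply]
    exact Finset.sum_congr rfl fun a _ => mul_comm _ _
  rw [hmul]
  by_cases hi : i ∈ J
  · rw [hgcol ⟨i, hi⟩]
    simp [Pi.single_apply, Subtype.ext_iff, eq_comm]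
  · have hzero : E.col i = 0 := funext fun a => hsupp i hi a
    have hij : i ≠ j := fun h => hi (h ▸ hj)
    simp [hzero, hij]

/-- **Uniqueness of full-rank burst errors for interleaved generalized Reed–Solomon codes.**
Let `s, t` be positive integers with `t ≤ n - k - 1`.  Let `E` and `E'` be `s × n`
matrices over `𝔽_q` such that `E` has exactly `t` nonzero columns and rank `t`,
`E'` has at most `t` nonzero columns, and every row of `E - E'` belongs to
`GRS_{n,k}`.  Then `E' = E`. -/
theorem interleaved_GRS_burst_error_unique
    {F : Type*} [Field F] [Fintype F] [DecidableEq F]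
    (n k s t : ℕ) (hk : 0 < k) (hkn : k ≤ n) (hs : 0 < s) (ht : 0 < t)
    (htnk : t ≤ n - k - 1)
    (α : Fin n → F) (hα : Function.Injective α)
    (ν : Fin n → F) (hν : ∀ i, ν i ≠ 0)
    (E E' : Matrix (Fin s) (Fin n) F)
    (hEsupp : (Finset.univ.filter fun i : Fin n => ∃ a, E a i ≠ 0).card = t)
    (hErank : E.rank = t)
    (hE'supp : (Finset.univ.filter fun i : Fin n => ∃ a, E' a i ≠ 0).card ≤ t)
    (hrow : ∀ a, ∃ f : F[X], f.degree < (k : WithBot ℕ) ∧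
      ∀ i, (E - E') a i = ν i * f.eval (α i)) :
    E' = E := by
  set J := Finset.univ.filter fun i : Fin n => ∃ a, E a i ≠ 0 with hJ
  set J' := Finset.univ.filter fun i : Fin n => ∃ a, E' a i ≠ 0 with hJ'
  have hE : ∀ i ∉ J, ∀ a, E a i = 0 := by
    intro i hi
    simpa [hJ] using hi
  have hE' : ∀ i ∉ J', ∀ a, E' a i = 0 := by
    intro i hi
    simpa [hJ'] using hi
  have hsub : J ⊆ J' := by
    intro j hj
    by_contra hj'
    obtain ⟨u, hu⟩ := exists_vecMul_eq_single hE (hErank.trans hEsupp.symm) hj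
    obtain ⟨f, hf, hword⟩ := exists_polynomial_vecMul_of_rows hrow u
    have hE'u : ∀ i ∉ J', Matrix.vecMul u E' i = 0 := by
      intro i hi
      simp [Matrix.vecMul, dotProduct, hE' i hi]
    have hcard : (insert j J').card ≤ n - k := (Finset.card_insert_le _ _).trans (by omega)
    have hf0 : f = 0 := grs_eval_eq_zero_of_support_subset hkn hα hν hf hcard fun i hi => by
      rw [Finset.mem_insert, not_or] at hi
      rw [← hword, Matrix.vecMul_sub, hu, Pi.sub_apply, hE'u i hi.2,
        Pi.single_eq_of_ne hi.1, sub_zero]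
    have hj1 := hword j
    rw [Matrix.vecMul_sub, hu, Pi.sub_apply, hE'u j hj', hf0] at hj1
    simp at hj1
  ext a i
  obtain ⟨f, hf, hword⟩ := hrow a
  have hf0 : f = 0 := grs_eval_eq_zero_of_support_subset (S := J') hkn hα hν hf (by omega)
    fun i hi => by
      rw [← hword, Matrix.sub_apply, hE' i hi, hE i fun h => hi (hsub h), sub_zero]
  have hai := hword i
  rw [hf0, Polynomial.eval_zero, mul_zero, Matrix.sub_apply] at hai
  exact (sub_eq_zero.mp hai).symm
end

section
/- Full rank of the syndrome matrix (core of the proof of Theorem 1). Let E be an s × n matrix over 𝔽_q with column support J of size t, where t ≤ r, and suppose the submatrix E_J has rank t. Then the r × s matrix H · Eᵀ has rank t. -/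
open Finset

namespace Matrix

/-- Left multiplication by a matrix with trivial kernel preserves the rank. -/
theorem rank_mul_eq_right_of_mulVec_injective {l m n K : Type*} [Fintype m] [Fintype n]
    [Field K] (A : Matrix l m K) (B : Matrix m n K) (hA : Function.Injective A.mulVec) :
    (A * B).rank = B.rank := by
  rw [rank, rank, mulVecLin_mul, LinearMap.range_comp]
  exact (LinearEquiv.finrank_eq (Submodule.equivMapOfInjective A.mulVecLin hA _)).symm

/-- A product only depends on the columns of the left factor and the rows of the right factor
indexed by a set outside of which the rows of the right factor vanish. -/
theorem submatrix_mul_submatrix_of_eq_zero {l m n R : Type*} [Fintype m]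
    [NonUnitalNonAssocSemiring R] (A : Matrix l m R) (B : Matrix m n R) (J : Finset m)
    (hB : ∀ i ∉ J, ∀ k, B i k = 0) :
    A.submatrix id (fun j : {i // i ∈ J} => j.1) * B.submatrix (fun j : {i // i ∈ J} => j.1) id =
      A * B := by
  ext a k
  simp only [mul_apply, submatrix_apply, id_eq]
  rw [Finset.sum_coe_sort J fun i => A a i * B i k]
  exact Finset.sum_subset (Finset.subset_univ J) fun i _ hi => by rw [hB i hi, mul_zero]

/-- A scaled rectangular Vandermonde matrix with distinct nodes and at least as many rows as
columns has trivial kernel. -/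
theorem mulVec_injective_of_scaled_vandermonde {ι K : Type*} [Fintype ι] [Field K] {r : ℕ}
    (hr : Fintype.card ι ≤ r) {α ν : ι → K} (hα : Function.Injective α) (hν : ∀ i, ν i ≠ 0)
    {A : Matrix (Fin r) ι K} (hA : ∀ j i, A j i = ν i * α i ^ (j : ℕ)) :
    Function.Injective A.mulVec := by
  refine (injective_iff_map_eq_zero A.mulVecLin).2 fun x hx => ?_
  let e := (Fintype.equivFin ι).symm
  have h : (fun k => ν (e k) * x (e k)) = 0 := by
    refine eq_zero_of_forall_pow_sum_mul_pow_eq_zero (hα.comp e.injective) fun k => ?_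
    have hk := congrFun hx (Fin.castLE hr k)
    simp only [mulVecLin_apply, mulVec, dotProduct, hA, Pi.zero_apply, Fin.val_castLE] at hk
    rw [← hk, ← e.sum_comp]
    exact Finset.sum_congr rfl fun i _ => by simp only [Function.comp_apply]; ring
  ext i
  have hi := congrFun h (e.symm i)
  simp only [Equiv.apply_symm_apply, Pi.zero_apply] at hi
  exact (mul_eq_zero.1 hi).resolve_left (hν i)

end Matrix

/-- **Full rank of the syndrome matrix.**
Let `H` be the `r × n` parity-check matrix of a generalized Reed–Solomon code,
with entries `H j i = ν i * (α i)^j`.  Let `E` be an `s × n` matrix over `𝔽_q`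
with column support `J` of size `t ≤ r`, and suppose the submatrix `E_J` has
rank `t`.  Then the `r × s` matrix `H * Eᵀ` has rank `t`. -/
theorem syndrome_matrix_full_rank
    {F : Type*} [Field F] [Fintype F] [DecidableEq F]
    (n r s t : ℕ) (hrn : r ≤ n) (htr : t ≤ r)
    (α : Fin n → F) (hα : Function.Injective α)
    (ν : Fin n → F) (hν : ∀ i, ν i ≠ 0)
    (H : Matrix (Fin r) (Fin n) F) (hH : ∀ j i, H j i = ν i * α i ^ (j : ℕ))
    (E : Matrix (Fin s) (Fin n) F)
    (J : Finset (Fin n)) (hJ : ∀ i, i ∈ J ↔ ∃ a, E a i ≠ 0) (hJcard : J.card = t)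
    (hEJrank : (E.submatrix id (fun j : {i // i ∈ J} => j.1)).rank = t) :
    (H * E.transpose).rank = t := by
  have hE : ∀ i ∉ J, ∀ a, E.transpose i a = 0 := fun i hi a => by
    by_contra h
    exact hi ((hJ i).2 ⟨a, h⟩)
  rw [← Matrix.submatrix_mul_submatrix_of_eq_zero H E.transpose J hE,
    Matrix.rank_mul_eq_right_of_mulVec_injective, ← Matrix.transpose_submatrix,
    Matrix.rank_transpose, hEJrank]
  exact Matrix.mulVec_injective_of_scaled_vandermonde (by simpa [hJcard] using htr)
    (hα.comp Subtype.val_injective) (fun i => hν i.1) fun j i => hH j i.1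
end

section
/- Parity-check characterization of the Goppa condition. Let q be a prime power, let α_1, …, α_n be pairwise distinct elements of 𝔽_q, and let g ∈ 𝔽_q[x] be a monic polynomial of degree r with g(α_i) ≠ 0 for all i. For every vector e ∈ 𝔽_q^n, the polynomial g(x) divides Σ_{i=1}^n e_i ∏_{j≠i}(x − α_j) if and only if Σ_{i=1}^n (e_i / g(α_i)) · α_i^l = 0 for all l = 0, 1, …, r − 1. -/
open Polynomial Finset

/-- The coefficients of a weighted sum of the quotients `g /ₘ (X - α_i)` are combinations of the
power sums `∑ i, u i * α i ^ l`. -/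
lemma coeff_sum_C_mul_divByMonic_X_sub_C {R ι : Type*} [CommRing R] [Fintype ι]
    (g : R[X]) (u α : ι → R) (k : ℕ) :
    (∑ i, C (u i) * (g /ₘ (X - C (α i)))).coeff k =
      ∑ j ∈ Icc (k + 1) g.natDegree, g.coeff j * ∑ i, u i * α i ^ (j - (k + 1)) := by
  simp_rw [finsetSum_coeff, coeff_C_mul, coeff_divByMonic_X_sub_C, mul_sum]
  rw [sum_comm]
  exact sum_congr rfl fun _ _ => sum_congr rfl fun _ _ => by ring

/-- For monic `g`, the weighted sum of the quotients `g /ₘ (X - α_i)` vanishes iff the first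
`g.natDegree` weighted power sums vanish. -/
lemma sum_C_mul_divByMonic_X_sub_C_eq_zero_iff {R ι : Type*} [CommRing R] [Fintype ι]
    {g : R[X]} (hg : g.Monic) (u α : ι → R) :
    ∑ i, C (u i) * (g /ₘ (X - C (α i))) = 0 ↔
      ∀ l < g.natDegree, ∑ i, u i * α i ^ l = 0 := by
  constructor
  · intro h l
    induction l using Nat.strong_induction_on with
    | _ l ih =>
      intro hl
      have hk := coeff_sum_C_mul_divByMonic_X_sub_C g u α (g.natDegree - 1 - l)
      rw [h, coeff_zero, sum_eq_single g.natDegree, hg.coeff_natDegree, one_mul,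
        show g.natDegree - (g.natDegree - 1 - l + 1) = l by omega] at hk
      · exact hk.symm
      · intro j hj hne
        rw [mem_Icc] at hj
        rw [ih _ (by omega) (by omega), mul_zero]
      · intro hj
        exact absurd (mem_Icc.2 ⟨by omega, le_rfl⟩) hj
  · intro h
    ext k
    rw [coeff_sum_C_mul_divByMonic_X_sub_C, coeff_zero]
    refine sum_eq_zero fun j hj => ?_
    rw [mem_Icc] at hj
    rw [h _ (by omega), mul_zero]

lemma degree_sum_C_mul_divByMonic_X_sub_C_lt {R ι : Type*} [CommRing R] [Fintype ι]
    {g : R[X]} (hg : g ≠ 0) (u α : ι → R) :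
    (∑ i, C (u i) * (g /ₘ (X - C (α i)))).degree < g.degree := by
  rw [degree_eq_natDegree hg, degree_lt_iff_coeff_zero]
  intro k hk
  rw [coeff_sum_C_mul_divByMonic_X_sub_C, Icc_eq_empty (by omega), sum_empty]

/-- Modulo `g`, the Goppa polynomial is `-∏ (X - α_j)` times a polynomial of degree less than
that of `g`. -/
lemma sum_C_mul_prod_erase_eq {F ι : Type*} [Field F] [Fintype ι] [DecidableEq ι]
    {g : F[X]} {α : ι → F} (hgα : ∀ i, g.eval (α i) ≠ 0) (e : ι → F) :
    ∑ i, C (e i) * ∏ j ∈ univ.erase i, (X - C (α j)) =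
      g * ∑ i, C (e i / g.eval (α i)) * ∏ j ∈ univ.erase i, (X - C (α j)) -
        (∏ j, (X - C (α j))) * ∑ i, C (e i / g.eval (α i)) * (g /ₘ (X - C (α i))) := by
  rw [mul_sum, mul_sum, ← sum_sub_distrib]
  refine sum_congr rfl fun i _ => ?_
  have hdiv : C (g.eval (α i)) + (X - C (α i)) * (g /ₘ (X - C (α i))) = g := by
    rw [← modByMonic_X_sub_C_eq_C_eval]
    exact modByMonic_add_div g _
  have he : C (e i) = C (e i / g.eval (α i)) * C (g.eval (α i)) := by
    rw [← C_mul, div_mul_cancel₀ _ (hgα i)]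
  rw [← mul_prod_erase univ (fun j => X - C (α j)) (mem_univ i)]
  linear_combination (∏ j ∈ univ.erase i, (X - C (α j))) * he +
    C (e i / g.eval (α i)) * (∏ j ∈ univ.erase i, (X - C (α j))) * hdiv

lemma isCoprime_prod_X_sub_C {F ι : Type*} [Field F] [Fintype ι]
    {g : F[X]} {α : ι → F} (hgα : ∀ i, g.eval (α i) ≠ 0) :
    IsCoprime g (∏ j, (X - C (α j))) := by
  refine IsCoprime.prod_right fun j _ => IsCoprime.symm ?_
  rw [(irreducible_X_sub_C (α j)).coprime_iff_not_dvd, dvd_iff_isRoot]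
  exact hgα j

/-- **Parity-check characterization of the Goppa condition.**
Let `α_1, …, α_n` be pairwise distinct elements of `𝔽_q` and `g` a monic polynomial
of degree `r` with `g(α_i) ≠ 0` for all `i`.  For every vector `e ∈ 𝔽_q^n`,
`g(x)` divides `Σ_i e_i ∏_{j ≠ i} (x - α_j)` if and only if
`Σ_i (e_i / g(α_i)) · α_i^l = 0` for all `l = 0, 1, …, r - 1`. -/
theorem goppa_parity_check_characterization
    {F : Type*} [Field F] [Fintype F] [DecidableEq F]
    (n r : ℕ)
    (α : Fin n → F) (hα : Function.Injective α)
    (g : F[X]) (hg : g.Monic) (hdeg : g.natDegree = r)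
    (hgα : ∀ i, g.eval (α i) ≠ 0)
    (e : Fin n → F) :
    (g ∣ ∑ i : Fin n,
        Polynomial.C (e i) * ∏ j ∈ Finset.univ.erase i, (X - Polynomial.C (α j)))
      ↔ ∀ l < r, ∑ i : Fin n, (e i / g.eval (α i)) * α i ^ l = 0 := by
  subst hdeg
  rw [← sum_C_mul_divByMonic_X_sub_C_eq_zero_iff hg, sum_C_mul_prod_erase_eq hgα,
    dvd_sub_right (dvd_mul_right _ _)]
  exact ⟨fun h => eq_zero_of_dvd_of_degree_lt ((isCoprime_prod_X_sub_C hgα).dvd_of_dvd_mul_left h)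
    (degree_sum_C_mul_divByMonic_X_sub_C_lt hg.ne_zero _ _), fun h => by simp [h]⟩
end

section
/- Dimension of Goppa codes. The Goppa code Γ(L, g) is an 𝔽_p-linear subspace of 𝔽_p^n of dimension at least n − m·r. -/
open Polynomial Finset

theorem AdjoinRoot.finrank_eq_mul_natDegree (K : Type*) {F : Type*} [Field K] [Field F] [Algebra K F]
    {g : F[X]} (hg : g.Monic) :
    Module.finrank K (AdjoinRoot g) = Module.finrank K F * g.natDegree := by
  rw [← Module.finrank_mul_finrank K F (AdjoinRoot g), (AdjoinRoot.powerBasis' hg).finrank,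
    AdjoinRoot.powerBasis'_dim]

theorem AdjoinRoot.linearCombination_mk_eq_zero_iff {K F ι : Type*} [Field K] [Field F]
    [Algebra K F] [Fintype ι] (g : F[X]) (P : ι → F[X]) (e : ι → K) :
    Fintype.linearCombination K (fun i => AdjoinRoot.mk g (P i)) e = 0 ↔
      g ∣ ∑ i, C (algebraMap K F (e i)) * P i := by
  rw [← AdjoinRoot.mk_eq_zero, map_sum, Fintype.linearCombination_apply]
  simp_rw [← Polynomial.algebraMap_apply, ← Algebra.smul_def, AdjoinRoot.smul_mk]

/-- **Dimension of Goppa codes.**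
The Goppa code `Γ(L, g)` is an `𝔽_p`-linear subspace of `𝔽_p^n` of dimension at
least `n - m·r`. -/
theorem goppa_code_dimension
    (p m n r : ℕ) [Fact p.Prime] (hm : 0 < m)
    {F : Type*} [Field F] [Fintype F] [DecidableEq F] [Algebra (ZMod p) F]
    (hcard : Fintype.card F = p ^ m)
    (α : Fin n → F) (hα : Function.Injective α)
    (g : F[X]) (hg : g.Monic) (hdeg : g.natDegree = r)
    (hgα : ∀ i, g.eval (α i) ≠ 0) :
    ∃ S : Submodule (ZMod p) (Fin n → ZMod p),
      (S : Set (Fin n → ZMod p)) =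
        {e | g ∣ ∑ i : Fin n,
          Polynomial.C (algebraMap (ZMod p) F (e i)) *
            ∏ j ∈ Finset.univ.erase i, (X - Polynomial.C (α j))} ∧
      n - m * r ≤ Module.finrank (ZMod p) S := by
  have hFm : Module.finrank (ZMod p) F = m :=
    Nat.pow_right_injective (Fact.out : p.Prime).two_le
      (by simpa [hcard] using (Module.card_eq_pow_finrank (K := ZMod p) (V := F)).symm)
  have : Module.Finite F (AdjoinRoot g) := (AdjoinRoot.powerBasis' hg).finite
  have : Module.Finite (ZMod p) (AdjoinRoot g) := Module.Finite.trans F _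
  let syndrome := Fintype.linearCombination (ZMod p) fun i =>
    AdjoinRoot.mk g (∏ j ∈ Finset.univ.erase i, (X - Polynomial.C (α j)))
  refine ⟨LinearMap.ker syndrome, ?_, ?_⟩
  · ext e
    exact AdjoinRoot.linearCombination_mk_eq_zero_iff g _ e
  · have hker := syndrome.finrank_range_add_finrank_ker
    have hrange := (LinearMap.range syndrome).finrank_le
    rw [AdjoinRoot.finrank_eq_mul_natDegree _ hg, hFm, hdeg] at hrange
    rw [Module.finrank_fin_fun] at hker
    omega
end

section
/- Minimum distance of binary irreducible Goppa codes. Suppose p = 2 (so q = 2^m) and g is irreducible over 𝔽_q. Then every nonzero codeword e ∈ Γ(L, g) has Hamming weight at least 2r + 1. -/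
open Polynomial Finset

/-- In characteristic two, the derivative of a polynomial over a perfect field is a square. -/
theorem exists_derivative_eq_sq {F : Type*} [Field F] [CharP F 2] [PerfectRing F 2] (s : F[X]) :
    ∃ h : F[X], derivative s = h ^ 2 := by
  have hd : derivative (derivative s) = 0 := by
    have h := congrFun (factorial_smul_hasseDeriv (R := F) 2) s
    have h2 : (2 : F[X]) = 0 := CharTwo.two_eq_zero
    simpa [h2] using h.symm
  exact ⟨_, by rw [← polynomial_expand_eq (R := F) (p := 2), expand_contract 2 hd two_ne_zero]⟩

/-- A squarefree product of linear factors whose derivative is divisible by an irreducible `g` has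
degree larger than `2 * deg g` in characteristic two. -/
theorem two_mul_natDegree_lt_card_of_dvd_derivative {F ι : Type*} [Field F] [CharP F 2]
    [PerfectRing F 2] {g : F[X]} (hg : Irreducible g) {α : ι → F} (hα : Function.Injective α)
    {S : Finset ι} (hS : S.Nonempty) (h : g ∣ derivative (∏ i ∈ S, (X - C (α i)))) :
    2 * g.natDegree < S.card := by
  set s := ∏ i ∈ S, (X - C (α i)) with hs
  have hsdeg : s.natDegree = S.card := by
    rw [hs, natDegree_prod_of_monic _ _ fun i _ => monic_X_sub_C (α i)]
    simp
  have hpos : 0 < s.natDegree := hsdeg ▸ hS.card_pos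
  have hsep : s.Separable := separable_prod_X_sub_C_iff'.mpr fun x _ y _ hxy => hα hxy
  have hne : derivative s ≠ 0 := fun h0 => by
    have hu : IsUnit s := isCoprime_zero_right.mp (h0 ▸ hsep)
    exact hpos.ne' (natDegree_eq_zero_of_isUnit hu)
  obtain ⟨t, ht⟩ := exists_derivative_eq_sq s
  rw [ht] at h hne
  have hsq : g ^ 2 ∣ t ^ 2 := pow_dvd_pow_of_dvd (hg.prime.dvd_of_dvd_pow h) 2
  have hle := natDegree_le_of_dvd hsq hne
  rw [natDegree_pow, ← ht] at hle
  exact hsdeg ▸ hle.trans_lt (natDegree_derivative_lt hpos.ne')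

/-- The Goppa syndrome numerator of a binary word is the derivative of its locator polynomial times
the linear factors outside the support. -/
theorem sum_algebraMap_mul_prod_erase_eq {F ι : Type*} [Field F] [Algebra (ZMod 2) F] [Fintype ι]
    [DecidableEq ι] (α : ι → F) (e : ι → ZMod 2) :
    ∑ i, C (algebraMap (ZMod 2) F (e i)) * ∏ j ∈ univ.erase i, (X - C (α j)) =
      derivative (∏ i with e i ≠ 0, (X - C (α i))) * ∏ i with ¬ e i ≠ 0, (X - C (α i)) := by
  rw [derivative_prod_finset, sum_mul, sum_filter]
  refine sum_congr rfl fun i _ => ?_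
  by_cases hi : e i = 0
  · simp [hi]
  have h1 : e i = 1 := by
    generalize e i = a at hi
    revert a
    decide
  rw [if_pos hi, h1, map_one, C_1, one_mul, derivative_X_sub_C, mul_one,
    ← prod_filter_mul_prod_filter_not (univ.erase i) (fun j => e j ≠ 0), filter_erase, filter_erase,
    erase_eq_of_notMem (s := univ.filter fun j => ¬ e j ≠ 0) (by simp [hi])]

/-- **Minimum distance of binary irreducible Goppa codes.**
Suppose `p = 2` (so `q = 2^m`) and `g` is irreducible over `𝔽_q`.  Then every
nonzero codeword `e ∈ Γ(L, g)` has Hamming weight at least `2r + 1`. -/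
theorem binary_goppa_code_min_distance
    (m n r : ℕ) (hm : 0 < m)
    {F : Type*} [Field F] [Fintype F] [DecidableEq F] [Algebra (ZMod 2) F]
    (hcard : Fintype.card F = 2 ^ m)
    (α : Fin n → F) (hα : Function.Injective α)
    (g : F[X]) (hg : g.Monic) (hdeg : g.natDegree = r)
    (hirr : Irreducible g)
    (hgα : ∀ i, g.eval (α i) ≠ 0)
    (e : Fin n → ZMod 2) (he : e ≠ 0)
    (hcode : g ∣ ∑ i : Fin n,
      Polynomial.C (algebraMap (ZMod 2) F (e i)) *
        ∏ j ∈ Finset.univ.erase i, (X - Polynomial.C (α j))) :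
    2 * r + 1 ≤ (Finset.univ.filter fun i : Fin n => e i ≠ 0).card := by
  have : CharP F 2 := charP_of_injective_algebraMap (algebraMap (ZMod 2) F).injective 2
  have : Fact (Nat.Prime 2) := ⟨Nat.prime_two⟩
  rw [sum_algebraMap_mul_prod_erase_eq] at hcode
  have hS : (univ.filter fun i => e i ≠ 0).Nonempty := by
    obtain ⟨i, hi⟩ := Function.ne_iff.mp he
    exact ⟨i, by simpa using hi⟩
  have hnot : ¬ g ∣ ∏ i with ¬ e i ≠ 0, (X - C (α i)) := fun h => by
    obtain ⟨i, -, hi⟩ := (hirr.prime.dvd_finsetProd_iff _).mp h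
    have hroot := hirr.dvd_symm (irreducible_X_sub_C (α i)) hi
    exact hgα i (dvd_iff_isRoot.mp hroot)
  rw [← hdeg]
  exact two_mul_natDegree_lt_card_of_dvd_derivative hirr hα hS
    ((hirr.prime.dvd_or_dvd hcode).resolve_right hnot)
end
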